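/- arXiv:2605.14983 — 2 statements merged into one kernel-verified Lean document; each statement's English description precedes it below -/
import Mathlib

section
/- Let u, v ∈ {0,1}^m be two votes over m candidates and let p ∈ (0,1) be such that |A(u)| = |A(v)| = p·m with 0 < p·m < m. Then pcc(u,v) = 1 − ham(u,v)/(2·m·p·(1−p)). -/
open Finset

/-- The number of voters approving candidate `c` in the election `V`. -/
def score {m n : ℕ} (V : Fin n → Fin m → Bool) (c : Fin m) : ℕ :=
  (Finset.univ.filter (fun i => V i c = true)).card

/-- The number of candidates approved in the vote `v`. -/
def voteLen {m : ℕ} (v : Fin m → Bool) : ℕ :=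
  (Finset.univ.filter (fun j => v j = true)).card

/-- The Hamming distance between two votes. -/
def hamm {m : ℕ} (u v : Fin m → Bool) : ℕ :=
  (Finset.univ.filter (fun j => u j ≠ v j)).card

/-- An election is an identity election if all voters cast the same vote. -/
def IsIdentity {m n : ℕ} (V : Fin n → Fin m → Bool) : Prop :=
  ∀ i i' : Fin n, V i = V i'

/-- The Approval Agreement index. -/
noncomputable def avAgr {m n : ℕ} (V : Fin n → Fin m → Bool) : ℝ :=
  (1 / (m : ℝ)) * ∑ c : Fin m, |1 - 2 * ((score V c : ℝ) / (n : ℝ))|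

/-- The average vote length. -/
noncomputable def avl {m n : ℕ} (V : Fin n → Fin m → Bool) : ℝ :=
  (∑ i : Fin n, (voteLen (V i) : ℝ)) / (n : ℝ)

/-- The reverse average vote length. -/
noncomputable def revAvl {m n : ℕ} (V : Fin n → Fin m → Bool) : ℝ :=
  (m : ℝ) - avl V

/-- The saturation of an election. -/
noncomputable def satr {m n : ℕ} (V : Fin n → Fin m → Bool) : ℝ :=
  avl V / (m : ℝ)

/-- A vote `u` is central for the election `V`: regarding each candidate, `u` agrees
with at least half of the voters. -/
def IsCentral {m n : ℕ} (V : Fin n → Fin m → Bool) (u : Fin m → Bool) : Prop :=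
  ∀ j : Fin m, (u j = true → n ≤ 2 * score V j) ∧ (u j = false → 2 * score V j ≤ n)

/-- The Central Agreement index, computed with the central vote `u`. -/
noncomputable def cntrAgrWith {m n : ℕ} (V : Fin n → Fin m → Bool) (u : Fin m → Bool) : ℝ :=
  1 - (∑ i : Fin n, (hamm (V i) u : ℝ)) / ((n : ℝ) * min (avl V) (revAvl V))

open scoped Classical in
/-- The Pearson correlation coefficient of two real vectors; by convention it is `1`
when one of the vectors is constant (zero denominator). -/
noncomputable def pcc {t : ℕ} (x y : Fin t → ℝ) : ℝ :=
  if Real.sqrt (∑ i, (x i - (∑ j, x j) / (t : ℝ)) ^ 2) = 0 ∨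
     Real.sqrt (∑ i, (y i - (∑ j, y j) / (t : ℝ)) ^ 2) = 0 then 1
  else (∑ i, (x i - (∑ j, x j) / (t : ℝ)) * (y i - (∑ j, y j) / (t : ℝ))) /
    (Real.sqrt (∑ i, (x i - (∑ j, x j) / (t : ℝ)) ^ 2) *
     Real.sqrt (∑ i, (y i - (∑ j, y j) / (t : ℝ)) ^ 2))

/-- A vote viewed as a real vector. -/
def toReal {m : ℕ} (v : Fin m → Bool) : Fin m → ℝ := fun j => if v j then 1 else 0

/-- The PCC Pairwise Agreement index. -/
noncomputable def pccAgr {m n : ℕ} (V : Fin n → Fin m → Bool) : ℝ :=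
  (1 / (n : ℝ) ^ 2) * ∑ i : Fin n, ∑ i' : Fin n, pcc (toReal (V i)) (toReal (V i'))

/-- The PCC⁺ Pairwise Agreement index. -/
noncomputable def pccPlusAgr {m n : ℕ} (V : Fin n → Fin m → Bool) : ℝ :=
  (1 / (n : ℝ) ^ 2) * ∑ i : Fin n, ∑ i' : Fin n, max 0 (pcc (toReal (V i)) (toReal (V i')))

/-- The Hamming Pairwise Agreement index. -/
noncomputable def pairAgr {m n : ℕ} (V : Fin n → Fin m → Bool) : ℝ :=
  1 - (∑ i : Fin n, ∑ i' : Fin n, (hamm (V i) (V i') : ℝ)) /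
    (2 * (n : ℝ) ^ 2 * (m : ℝ) * satr V * (1 - satr V))

/-- The Jaccard similarity `1 - jacc(u,v)` of two votes. -/
noncomputable def jaccSim {m : ℕ} (u v : Fin m → Bool) : ℝ :=
  ((Finset.univ.filter (fun j => u j = true ∧ v j = true)).card : ℝ) /
  ((Finset.univ.filter (fun j => u j = true ∨ v j = true)).card : ℝ)

/-- The Jaccard Pairwise Agreement index. -/
noncomputable def jaccAgr {m n : ℕ} (V : Fin n → Fin m → Bool) : ℝ :=
  (1 / (n : ℝ) ^ 2) * ∑ i : Fin n, ∑ i' : Fin n, jaccSim (V i) (V i')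

/-- The canonical central vote of an election. -/
def centralVote {m n : ℕ} (V : Fin n → Fin m → Bool) : Fin m → Bool :=
  fun j => decide (n < 2 * score V j)

/-- The central Hamming distance of an election. -/
def chd {m n : ℕ} (V : Fin n → Fin m → Bool) : ℕ :=
  ∑ i : Fin n, hamm (V i) (centralVote V)

/-- The total Hamming distance over all ordered pairs of votes. -/
def ehd {m n : ℕ} (V : Fin n → Fin m → Bool) : ℕ :=
  ∑ i : Fin n, ∑ i' : Fin n, hamm (V i) (V i')

/-- The matched normalized Hamming distance between two collections of votes. -/
noncomputable def mHam {m : ℕ} (k N : ℕ) (hk : 0 < k) (hN : 0 < N)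
    (U : Fin k → Fin m → Bool) (W : Fin N → Fin m → Bool) : ℝ :=
  ((Finset.univ.inf' ⟨Equiv.refl (Fin (k * N)), Finset.mem_univ _⟩
    (fun π : Equiv.Perm (Fin (k * N)) =>
      ∑ i : Fin (k * N),
        hamm (U ⟨i.val % k, Nat.mod_lt _ hk⟩)
             (W ⟨(π i).val % N, Nat.mod_lt _ hN⟩)) : ℕ) : ℝ) /
  ((k : ℝ) * (N : ℝ) * (m : ℝ))

theorem sum_toReal_aux {m : ℕ} (u : Fin m → Bool) :
    ∑ j, toReal u j = (voteLen u : ℝ) := by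
  simp [toReal, voteLen]

theorem cov_aux {m : ℕ} (p : ℝ) (u v : Fin m → Bool)
    (hu : (voteLen u : ℝ) = p * m) (hv : (voteLen v : ℝ) = p * m) :
    ∑ i, (toReal u i - p) * (toReal v i - p) = m * p * (1 - p) - (hamm u v : ℝ) / 2 := by
  have hh : (hamm u v : ℝ) = ∑ j, (if u j ≠ v j then (1 : ℝ) else 0) := by
    rw [Finset.sum_boole]; rfl
  have key : ∀ i, (toReal u i - p) * (toReal v i - p)
      = p ^ 2 + (1 / 2 - p) * toReal u i + (1 / 2 - p) * toReal v i
        - (1 / 2) * (if u i ≠ v i then (1 : ℝ) else 0) := by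
    intro i
    unfold toReal
    cases u i <;> cases v i <;> simp <;> ring
  rw [Finset.sum_congr rfl (fun i _ => key i), Finset.sum_sub_distrib, Finset.sum_add_distrib,
    Finset.sum_add_distrib, ← Finset.mul_sum, ← Finset.mul_sum, ← Finset.mul_sum,
    sum_toReal_aux, sum_toReal_aux, hu, hv, ← hh]
  simp
  ring

/-- for two votes with `|A(u)| = |A(v)| = p·m` and `0 < p·m < m`,
`pcc(u,v) = 1 - ham(u,v)/(2·m·p·(1-p))`. -/
theorem pcc_eq_one_sub_ham {m : ℕ} (p : ℝ) (hp0 : 0 < p) (hp1 : p < 1)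
    (u v : Fin m → Bool)
    (hu : (voteLen u : ℝ) = p * m) (hv : (voteLen v : ℝ) = p * m)
    (hpm0 : 0 < p * (m : ℝ)) (hpm1 : p * (m : ℝ) < m) :
    pcc (toReal u) (toReal v) = 1 - (hamm u v : ℝ) / (2 * m * p * (1 - p)) := by
  have hm : (0 : ℝ) < m := by linarith
  have hmu : (∑ j, toReal u j) / (m : ℝ) = p := by
    rw [sum_toReal_aux, hu]; field_simp
  have hmv : (∑ j, toReal v j) / (m : ℝ) = p := by
    rw [sum_toReal_aux, hv]; field_simp
  have hpos : 0 < (m : ℝ) * p * (1 - p) := mul_pos (mul_pos hm hp0) (by linarith)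
  have su : ∑ i, (toReal u i - p) ^ 2 = m * p * (1 - p) := by
    have h := cov_aux p u u hu hu
    simpa [hamm, pow_two] using h
  have sv : ∑ i, (toReal v i - p) ^ 2 = m * p * (1 - p) := by
    have h := cov_aux p v v hv hv
    simpa [hamm, pow_two] using h
  have hs : Real.sqrt ((m : ℝ) * p * (1 - p)) ≠ 0 := (Real.sqrt_pos.mpr hpos).ne'
  unfold pcc
  rw [hmu, hmv, su, sv, if_neg (by simp only [or_self]; exact hs), cov_aux p u v hu hv,
    Real.mul_self_sqrt hpos.le]
  have h1 : (1 - p) ≠ 0 := by linarith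
  field_simp
end

section
/- Fix positive integers m, n and a rational α ∈ [0,1] such that α·n·m is an integer, and let E=(C,V) be an approval election with m candidates, n voters, and satr(E) = α such that for each two candidates c_j, c_k ∈ C we have ||A(c_j)| − |A(c_k)|| ≤ 1. Then ehd(E) ≥ ehd(E') for every approval election E' with m candidates, n voters, and saturation α. -/
open Finset

/-- Total Hamming distance expressed through the approval scores. -/
lemma ehd_eq_score {m n : ℕ} (V : Fin n → Fin m → Bool) :
    (ehd V : ℤ) = ∑ c : Fin m, (2 * n * (score V c : ℤ) - 2 * (score V c : ℤ) ^ 2) := by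
  have hs : ∀ c, (score V c : ℤ) = ∑ i : Fin n, (if V i c = true then (1 : ℤ) else 0) := by
    intro c
    simp [score]
  have hh : ∀ i i', (hamm (V i) (V i') : ℤ) = ∑ c : Fin m,
      ((if V i c = true then (1 : ℤ) else 0) + (if V i' c = true then (1 : ℤ) else 0)
        - 2 * ((if V i c = true then (1 : ℤ) else 0) * (if V i' c = true then (1 : ℤ) else 0))) := by
    intro i i'
    rw [hamm, Finset.card_filter, Nat.cast_sum]
    refine Finset.sum_congr rfl fun c _ => ?_
    cases V i c <;> cases V i' c <;> simp
  unfold ehd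
  push_cast
  simp_rw [hh]
  rw [Finset.sum_congr rfl fun i _ => Finset.sum_comm, Finset.sum_comm]
  refine Finset.sum_congr rfl fun c _ => ?_
  rw [hs c]
  simp_rw [Finset.sum_sub_distrib, Finset.sum_add_distrib, ← Finset.mul_sum]
  rw [← Finset.sum_mul]
  simp only [Finset.sum_const, ← Finset.mul_sum, Finset.card_univ, Fintype.card_fin, nsmul_eq_mul]
  ring

/-- Double counting of approvals. -/
lemma sum_voteLen_eq {m n : ℕ} (V : Fin n → Fin m → Bool) :
    ∑ i : Fin n, voteLen (V i) = ∑ c : Fin m, score V c := by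
  simp only [voteLen, score, Finset.card_filter]
  exact Finset.sum_comm

/-- if the approval scores of each two candidates differ by at most one,
then `ehd(E)` is largest among elections with `m` candidates, `n` voters,
and saturation `α`. -/
theorem ehd_largest_of_balanced {m n : ℕ} (hm : 0 < m) (hn : 0 < n) (α : ℝ)
    (hα0 : 0 ≤ α) (hα1 : α ≤ 1)
    (V : Fin n → Fin m → Bool)
    (hsat : ((∑ i : Fin n, voteLen (V i) : ℕ) : ℝ) = α * n * m)
    (hbal : ∀ c c' : Fin m, score V c ≤ score V c' + 1) :
    ∀ V' : Fin n → Fin m → Bool,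
      ((∑ i : Fin n, voteLen (V' i) : ℕ) : ℝ) = α * n * m → ehd V' ≤ ehd V := by
  intro V' hsat'
  have htot : ∑ c : Fin m, score V' c = ∑ c : Fin m, score V c := by
    rw [← sum_voteLen_eq, ← sum_voteLen_eq]
    exact_mod_cast hsat'.trans hsat.symm
  have htotZ : ∑ c : Fin m, (score V' c : ℤ) = ∑ c : Fin m, (score V c : ℤ) := by
    exact_mod_cast htot
  obtain ⟨c₀, -, hc₀⟩ := Finset.exists_min_image (Finset.univ : Finset (Fin m)) (score V)
    ⟨⟨0, hm⟩, Finset.mem_univ _⟩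
  set k : ℤ := (score V c₀ : ℤ) with hk
  have hV : (ehd V : ℤ) = ∑ c : Fin m,
      ((2 * n - 2 * (2 * k + 1)) * (score V c : ℤ) + 2 * (k * (k + 1))) := by
    rw [ehd_eq_score]
    refine Finset.sum_congr rfl fun c _ => ?_
    have h1 := hc₀ c (Finset.mem_univ _)
    have h2 := hbal c c₀
    have h3 : (score V c : ℤ) = k ∨ (score V c : ℤ) = k + 1 := by omega
    rcases h3 with h | h <;> rw [h] <;> ring
  have hV' : (ehd V' : ℤ) ≤ ∑ c : Fin m,
      ((2 * n - 2 * (2 * k + 1)) * (score V' c : ℤ) + 2 * (k * (k + 1))) := by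
    rw [ehd_eq_score]
    refine Finset.sum_le_sum fun c _ => ?_
    have h3 : 0 ≤ ((score V' c : ℤ) - k) * ((score V' c : ℤ) - k - 1) := by
      rcases le_or_gt (score V' c : ℤ) k with h | h
      · exact mul_nonneg_of_nonpos_of_nonpos (by omega) (by omega)
      · exact mul_nonneg (by omega) (by omega)
    nlinarith [h3]
  rw [Finset.sum_add_distrib, ← Finset.mul_sum] at hV hV'
  rw [htotZ, ← hV] at hV'
  exact_mod_cast hV'
end
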